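/- arXiv:1807.04125 — 3 statements merged into one kernel-verified Lean document; each statement's English description precedes it below -/
import Mathlib

section
/- Let λ be a nonzero real number, let β, α be real numbers with β ≥ 1 and α > 1, and suppose α = 2βm for a positive integer m. Define, for y > 0, F(y) = (1/λ) · y^{1-2β-α}/(1-2β-α) + ∑_{n=-m}^{-1} (-1)^{n+m+1} (λ^{2n+2m+1}/Γ(2n+2m+3)) · y^{2βn+1}/(2βn+1) + ∑_{n=0}^{∞} (-1)^{n+m+1} (λ^{2n+2m+1}/Γ(2n+2m+3)) · y^{2βn+1}/(2βn+1). Then for every x > 0, F is differentiable at x and F′(x) = cos(λ x^β)/(λ x^{2β+α}). -/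
open Real

/-- The power antiderivative of `x ^ r` away from `r = -1`. -/
theorem hasDerivAt_rpow_add_one_div {r x : ℝ} (hr : r + 1 ≠ 0) (hx : 0 < x) :
    HasDerivAt (fun y : ℝ => y ^ (r + 1) / (r + 1)) (x ^ r) x := by
  have h := (Real.hasDerivAt_rpow_const (p := r + 1) (Or.inl hx.ne')).div_const (r + 1)
  rwa [add_sub_cancel_right, mul_div_cancel_left₀ _ hr] at h

theorem Int.sum_Icc_neg_eq_sum_range {M : Type*} [AddCommMonoid M] (m : ℕ) (f : ℤ → M) :
    ∑ n ∈ Finset.Icc (-(m : ℤ)) (-1), f n = ∑ k ∈ Finset.range m, f ((k : ℤ) - m) := by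
  symm
  refine Finset.sum_nbij' (fun k => (k : ℤ) - m) (fun n => (n + m).toNat) ?_ ?_ ?_ ?_ ?_
  · intro k hk
    simp only [Finset.mem_range, Finset.mem_Icc] at *
    omega
  · intro n hn
    simp only [Finset.mem_range, Finset.mem_Icc] at *
    omega
  · intro k _
    simp
  · intro n hn
    simp only [Finset.mem_Icc] at hn
    omega
  · intro k _
    rfl

theorem Real.Gamma_two_mul_add_three (k : ℕ) :
    Real.Gamma (2 * (k : ℝ) + 3) = ((2 * (k + 1)).factorial : ℝ) := by
  rw [← Real.Gamma_nat_eq_factorial]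
  congr 1
  push_cast
  ring

/-- A term of the cosine series at `l * x ^ β`, divided by `l * x ^ (2 * β + 2 * β * m)`. -/
theorem cos_series_term_div {l β x : ℝ} (hl : l ≠ 0) (hx : 0 < x) (m k : ℕ) :
    (-1 : ℝ) ^ (k + 1) * (l ^ (2 * k + 1) / Real.Gamma (2 * (k : ℝ) + 3)) *
        x ^ (2 * β * ((k : ℝ) - m)) =
      ((-1 : ℝ) ^ (k + 1) * (l * x ^ β) ^ (2 * (k + 1)) / ((2 * (k + 1)).factorial : ℝ)) /
        (l * x ^ (2 * β + 2 * β * m)) := by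
  have hpow : x ^ (2 * β * ((k : ℝ) - m)) =
      (x ^ β) ^ (2 * (k + 1)) / x ^ (2 * β + 2 * β * m) := by
    rw [← Real.rpow_mul_natCast hx.le, ← Real.rpow_sub hx]
    congr 1
    push_cast
    ring
  have hx' : x ^ (2 * β + 2 * β * m) ≠ 0 := (Real.rpow_pos_of_pos hx _).ne'
  have hf : ((2 * (k + 1)).factorial : ℝ) ≠ 0 := by positivity
  rw [hpow, Real.Gamma_two_mul_add_three, mul_pow]
  field_simp
  ring

theorem summable_abs_cos_series_term_div {l β x : ℝ} (hl : l ≠ 0) (hx : 0 < x) (m : ℕ) :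
    Summable fun n : ℕ =>
      |(-1 : ℝ) ^ (n + m + 1) *
        (l ^ (2 * n + 2 * m + 1) / Real.Gamma (2 * (n : ℝ) + 2 * (m : ℝ) + 3)) *
        x ^ (2 * β * (n : ℝ))| := by
  have h := (((summable_nat_add_iff (m + 1)).2
    (Real.hasSum_cos (l * x ^ β)).summable).div_const (l * x ^ (2 * β + 2 * β * m))).abs
  refine h.congr fun n => ?_
  have := cos_series_term_div (β := β) hl hx m (n + m)
  rw [← add_assoc, ← this]
  push_cast
  ring_nf

/-- The cosine series at `l * x ^ β`, divided termwise by `l * x ^ (2 * β + 2 * β * m)`. -/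
theorem cos_div_eq_sum_add_tsum {l β x : ℝ} (hl : l ≠ 0) (hx : 0 < x) (m : ℕ) :
    (1 / l) * x ^ (-2 * β - 2 * β * m) +
        (∑ k ∈ Finset.range m, (-1 : ℝ) ^ (k + 1) *
          (l ^ (2 * k + 1) / Real.Gamma (2 * (k : ℝ) + 3)) * x ^ (2 * β * ((k : ℝ) - m))) +
        ∑' n : ℕ, (-1 : ℝ) ^ (n + m + 1) *
          (l ^ (2 * n + 2 * m + 1) / Real.Gamma (2 * (n : ℝ) + 2 * (m : ℝ) + 3)) *
          x ^ (2 * β * (n : ℝ)) =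
      Real.cos (l * x ^ β) / (l * x ^ (2 * β + 2 * β * m)) := by
  have hcos := Real.hasSum_cos (l * x ^ β)
  have htail : ∀ n : ℕ, (-1 : ℝ) ^ (n + m + 1) *
      (l ^ (2 * n + 2 * m + 1) / Real.Gamma (2 * (n : ℝ) + 2 * (m : ℝ) + 3)) *
      x ^ (2 * β * (n : ℝ)) =
      ((-1 : ℝ) ^ (n + (m + 1)) * (l * x ^ β) ^ (2 * (n + (m + 1))) /
        ((2 * (n + (m + 1))).factorial : ℝ)) / (l * x ^ (2 * β + 2 * β * m)) := by
    intro n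
    rw [← add_assoc n m 1, ← cos_series_term_div (β := β) hl hx m (n + m)]
    push_cast
    ring_nf
  rw [tsum_congr htail, tsum_div_const,
    Finset.sum_congr rfl fun k _ => cos_series_term_div (β := β) hl hx m k,
    ← Finset.sum_div, ← hcos.tsum_eq, ← hcos.summable.sum_add_tsum_nat_add (m + 1),
    Finset.sum_range_succ', add_div, add_div]
  have hneg : x ^ (-2 * β - 2 * β * m) = (x ^ (2 * β + 2 * β * m))⁻¹ := by
    rw [← Real.rpow_neg hx.le]
    congr 1
    ring
  rw [hneg]
  simp only [pow_zero, mul_zero, Nat.factorial_zero, Nat.cast_one]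
  ring

theorem hasDerivAt_tsum_cos_series_antideriv {l β x : ℝ} (hl : l ≠ 0) (hβ : 0 ≤ β)
    (hx : 0 < x) (m : ℕ) :
    HasDerivAt (fun y : ℝ => ∑' n : ℕ, (-1 : ℝ) ^ (n + m + 1) *
        (l ^ (2 * n + 2 * m + 1) / Real.Gamma (2 * (n : ℝ) + 2 * (m : ℝ) + 3)) *
        (y ^ (2 * β * (n : ℝ) + 1) / (2 * β * (n : ℝ) + 1)))
      (∑' n : ℕ, (-1 : ℝ) ^ (n + m + 1) *
        (l ^ (2 * n + 2 * m + 1) / Real.Gamma (2 * (n : ℝ) + 2 * (m : ℝ) + 3)) *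
        x ^ (2 * β * (n : ℝ))) x := by
  have hxt : x ∈ Set.Ioo 0 (x + 1) := ⟨hx, lt_add_one x⟩
  refine hasDerivAt_tsum_of_isPreconnected (𝕜 := ℝ) (F := ℝ)
    (g' := fun n y => (-1 : ℝ) ^ (n + m + 1) *
      (l ^ (2 * n + 2 * m + 1) / Real.Gamma (2 * (n : ℝ) + 2 * (m : ℝ) + 3)) *
      y ^ (2 * β * (n : ℝ)))
    (summable_abs_cos_series_term_div (β := β) hl (by positivity : 0 < x + 1) m)
    isOpen_Ioo isPreconnected_Ioo (fun n y hy => ?_) (fun n y hy => ?_) hxt ?_ hxt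
  · have hn : 2 * β * (n : ℝ) + 1 ≠ 0 := by positivity
    exact (hasDerivAt_rpow_add_one_div hn hy.1).const_mul _
  · rw [Real.norm_eq_abs, abs_mul, abs_mul _ ((x + 1) ^ _),
      abs_of_pos (Real.rpow_pos_of_pos hy.1 _),
      abs_of_pos (Real.rpow_pos_of_pos (by positivity : 0 < x + 1) _)]
    exact mul_le_mul_of_nonneg_left
      (Real.rpow_le_rpow hy.1.le hy.2.le (by positivity)) (abs_nonneg _)
  · refine Summable.of_norm_bounded
      ((summable_abs_cos_series_term_div (β := β) hl hx m).mul_right x) fun n => ?_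
    have hp : 0 < x ^ (2 * β * (n : ℝ)) := Real.rpow_pos_of_pos hx _
    have hd : 1 ≤ 2 * β * (n : ℝ) + 1 := le_add_of_nonneg_left (by positivity)
    have hq : 0 ≤ x ^ (2 * β * (n : ℝ)) * x := by positivity
    rw [Real.norm_eq_abs, abs_mul, abs_mul _ (x ^ (2 * β * (n : ℝ))), abs_of_pos hp,
      mul_assoc |(-1 : ℝ) ^ _ * _|, Real.rpow_add_one hx.ne',
      abs_of_nonneg (div_nonneg hq (zero_le_one.trans hd))]
    exact mul_le_mul_of_nonneg_left (div_le_self hq hd) (abs_nonneg _)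

/-- Theorem 3, case ε = 0 (cosine integral with `α = 2βm`). -/
theorem cos_integral_eps_zero (lam β α : ℝ) (hlam : lam ≠ 0) (hβ : 1 ≤ β) (hα : 1 < α)
    (m : ℕ) (hm : 0 < m) (hαm : α = 2 * β * m) :
    ∀ x : ℝ, 0 < x →
      HasDerivAt (fun y : ℝ =>
        (1 / lam) * (y ^ (1 - 2 * β - α) / (1 - 2 * β - α)) +
        (∑ n ∈ Finset.Icc (-(m : ℤ)) (-1 : ℤ),
          (-1 : ℝ) ^ (n + (m : ℤ) + 1) *
            (lam ^ (2 * n + 2 * (m : ℤ) + 1) / Real.Gamma (2 * (n : ℝ) + 2 * (m : ℝ) + 3)) *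
            (y ^ (2 * β * (n : ℝ) + 1) / (2 * β * (n : ℝ) + 1))) +
        ∑' n : ℕ,
          (-1 : ℝ) ^ (n + m + 1) *
            (lam ^ (2 * n + 2 * m + 1) / Real.Gamma (2 * (n : ℝ) + 2 * (m : ℝ) + 3)) *
            (y ^ (2 * β * (n : ℝ) + 1) / (2 * β * (n : ℝ) + 1)))
        (Real.cos (lam * x ^ β) / (lam * x ^ (2 * β + α))) x := by
  intro x hx
  have hpole : -2 * β - α + 1 ≠ 0 := by linarith
  have hhead := (hasDerivAt_rpow_add_one_div hpole hx).const_mul (1 / lam)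
  have hsum : HasDerivAt (fun y : ℝ => ∑ k ∈ Finset.range m, (-1 : ℝ) ^ (k + 1) *
      (lam ^ (2 * k + 1) / Real.Gamma (2 * (k : ℝ) + 3)) *
      (y ^ (2 * β * ((k : ℝ) - m) + 1) / (2 * β * ((k : ℝ) - m) + 1)))
      (∑ k ∈ Finset.range m, (-1 : ℝ) ^ (k + 1) *
        (lam ^ (2 * k + 1) / Real.Gamma (2 * (k : ℝ) + 3)) *
        x ^ (2 * β * ((k : ℝ) - m))) x := by
    refine HasDerivAt.fun_sum fun k hk => ?_
    have hkm : (k : ℝ) + 1 ≤ m := by exact_mod_cast Finset.mem_range.1 hk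
    have hne : 2 * β * ((k : ℝ) - m) + 1 ≠ 0 := by nlinarith
    exact (hasDerivAt_rpow_add_one_div hne hx).const_mul _
  have htail := hasDerivAt_tsum_cos_series_antideriv hlam (zero_le_one.trans hβ) hx m
  have h := (hhead.add hsum).add htail
  rw [show -2 * β - α = -2 * β - 2 * β * m by rw [hαm],
    cos_div_eq_sum_add_tsum hlam hx, ← hαm] at h
  refine h.congr_of_eventuallyEq (Filter.Eventually.of_forall fun y => ?_)
  simp only [Pi.add_apply]
  rw [Int.sum_Icc_neg_eq_sum_range, show -2 * β - α + 1 = 1 - 2 * β - α by ring]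
  congr 2
  refine Finset.sum_congr rfl fun k _ => ?_
  have hsign : (-1 : ℝ) ^ ((k : ℤ) - m + m + 1) = (-1) ^ (k + 1) := by
    rw [sub_add_cancel]
    exact_mod_cast zpow_natCast (-1 : ℝ) (k + 1)
  have hlpow : lam ^ (2 * ((k : ℤ) - m) + 2 * m + 1) = lam ^ (2 * k + 1) := by
    rw [show 2 * ((k : ℤ) - m) + 2 * m + 1 = ((2 * k + 1 : ℕ) : ℤ) by push_cast; ring,
      zpow_natCast]
  rw [hsign, hlpow]
  push_cast
  rw [show 2 * ((k : ℝ) - m) + 2 * m + 3 = 2 * k + 3 by ring]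
end

section
/- Let λ be a nonzero real number, let β, α be real numbers with β ≥ 1 and α > 1, let m be a natural number and ε a real number with -2β < ε < 2β, ε ≠ 0, ε ≠ 1, such that α = 2βm + ε, and assume additionally that ε ≠ 2βn + 1 for every integer n with -m ≤ n ≤ -1. Define, for y > 0, F(y) = (1/λ) · y^{1-2β-α}/(1-2β-α) + (λ^{2m+1}/Γ(2m+3)) · y^{1-ε}/(1-ε) + ∑_{n=-m}^{-1} (λ^{2n+2m+1}/Γ(2n+2m+3)) · y^{2βn-ε+1}/(2βn-ε+1) + ∑_{n=0}^{∞} (λ^{2n+2m+3}/Γ(2n+2m+5)) · y^{2βn+2β-ε+1}/(2βn+2β-ε+1). Then for every x > 0, F is differentiable at x and F′(x) = cosh(λ x^β)/(λ x^{2β+α}). -/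
open Real

/-- Antiderivative of a single real power, with the exponent in the form `q = p + 1`. -/
lemma hasDerivAt_const_mul_rpow_div {c p q x : ℝ} (hx : 0 < x) (hq : q ≠ 0) (hqp : q = p + 1) :
    HasDerivAt (fun y : ℝ => c * (y ^ q / q)) (c * x ^ p) x := by
  have h := ((Real.hasDerivAt_rpow_const (x := x) (p := q) (Or.inl hx.ne')).div_const q).const_mul c
  have hp : q - 1 = p := by linarith
  rw [hp, mul_div_right_comm, div_self hq, one_mul] at h
  exact h

/-- The terms of the power series of `cosh (lam * x ^ β)` divided by `lam * x ^ s`. -/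
lemma zpow_div_Gamma_mul_rpow {lam β s x : ℝ} (hlam : lam ≠ 0) (hx : 0 < x) (k : ℕ) {z : ℤ}
    {g p : ℝ} (hz : z = 2 * k - 1) (hg : g = 2 * k + 1) (hp : p = 2 * β * k - s) :
    lam ^ z / Real.Gamma g * x ^ p =
      (lam * x ^ β) ^ (2 * k) / ((2 * k).factorial : ℝ) / (lam * x ^ s) := by
  have h₁ : Real.Gamma g = ((2 * k).factorial : ℝ) := by
    rw [hg, ← Real.Gamma_nat_eq_factorial]
    push_cast
    rfl
  have h₂ : x ^ p = (x ^ β) ^ (2 * k) / x ^ s := by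
    rw [hp, Real.rpow_sub hx, ← Real.rpow_natCast (x ^ β), ← Real.rpow_mul hx.le]
    congr 2
    push_cast
    ring
  have h₃ : lam ^ z = lam ^ (2 * k) / lam := by
    rw [hz, zpow_sub_one₀ hlam, div_eq_mul_inv]
    norm_cast
  rw [h₁, h₂, h₃, mul_pow]
  have := (Real.rpow_pos_of_pos hx s).ne'
  field_simp

lemma pow_div_Gamma_mul_rpow {lam β s x : ℝ} (hlam : lam ≠ 0) (hx : 0 < x) (k : ℕ) {j : ℕ}
    {g p : ℝ} (hj : j + 1 = 2 * k) (hg : g = 2 * k + 1) (hp : p = 2 * β * k - s) :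
    lam ^ j / Real.Gamma g * x ^ p =
      (lam * x ^ β) ^ (2 * k) / ((2 * k).factorial : ℝ) / (lam * x ^ s) := by
  rw [← zpow_natCast]
  exact zpow_div_Gamma_mul_rpow hlam hx k (by omega) hg hp

lemma summable_pow_two_mul_div_factorial (r : ℝ) :
    Summable fun k : ℕ => r ^ (2 * k) / ((2 * k).factorial : ℝ) :=
  (Real.hasSum_cosh r).summable

/-- Termwise differentiation of a series of real powers with exponents `p n + 1`, `p n ≥ 0`. -/
lemma hasDerivAt_tsum_const_mul_rpow_div {c p q : ℕ → ℝ} (hp : ∀ n, 0 ≤ p n)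
    (hq : ∀ n, q n = p n + 1) (hsum : ∀ y : ℝ, 0 < y → Summable fun n => |c n| * y ^ p n)
    {x : ℝ} (hx : 0 < x) :
    HasDerivAt (fun y : ℝ => ∑' n, c n * (y ^ q n / q n)) (∑' n, c n * x ^ p n) x := by
  have hmem : x ∈ Set.Ioo 0 (2 * x) := ⟨hx, by linarith⟩
  refine hasDerivAt_tsum_of_isPreconnected (t := Set.Ioo 0 (2 * x)) (hsum (2 * x) (by linarith))
    isOpen_Ioo isPreconnected_Ioo
    (fun n y hy => hasDerivAt_const_mul_rpow_div hy.1 (by linarith [hp n, hq n]) (hq n))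
    (fun n y hy => ?_) hmem ?_ hmem
  · rw [Real.norm_eq_abs, abs_mul, abs_of_nonneg (Real.rpow_nonneg hy.1.le _)]
    exact mul_le_mul_of_nonneg_left (Real.rpow_le_rpow hy.1.le hy.2.le (hp n)) (abs_nonneg _)
  · refine Summable.of_norm_bounded ((hsum x hx).mul_right x) fun n => ?_
    have hq1 : 1 ≤ q n := by linarith [hp n, hq n]
    have hpos := Real.rpow_nonneg hx.le (q n)
    rw [Real.norm_eq_abs, abs_mul, abs_of_nonneg (div_nonneg hpos (by linarith)), mul_assoc]
    refine mul_le_mul_of_nonneg_left ?_ (abs_nonneg _)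
    rw [← Real.rpow_add_one hx.ne', ← hq n]
    exact div_le_self hpos hq1

/-- Theorem 4, case ε ∈ (-2β,0)∪(0,1)∪(1,2β) (hyperbolic cosine integral with `α = 2βm + ε`). -/
theorem cosh_integral_eps_general (lam β α ε : ℝ) (hlam : lam ≠ 0) (hβ : 1 ≤ β) (hα : 1 < α)
    (m : ℕ) (hε₁ : -(2 * β) < ε) (hε₂ : ε < 2 * β) (hε₀ : ε ≠ 0) (hε₃ : ε ≠ 1)
    (hαm : α = 2 * β * m + ε)
    (hden : ∀ n : ℤ, -(m : ℤ) ≤ n → n ≤ -1 → ε ≠ 2 * β * (n : ℝ) + 1) :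
    ∀ x : ℝ, 0 < x →
      HasDerivAt (fun y : ℝ =>
        (1 / lam) * (y ^ (1 - 2 * β - α) / (1 - 2 * β - α)) +
        (lam ^ (2 * m + 1) / Real.Gamma (2 * (m : ℝ) + 3)) * (y ^ (1 - ε) / (1 - ε)) +
        (∑ n ∈ Finset.Icc (-(m : ℤ)) (-1 : ℤ),
          (lam ^ (2 * n + 2 * (m : ℤ) + 1) / Real.Gamma (2 * (n : ℝ) + 2 * (m : ℝ) + 3)) *
            (y ^ (2 * β * (n : ℝ) - ε + 1) / (2 * β * (n : ℝ) - ε + 1))) +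
        ∑' n : ℕ,
          (lam ^ (2 * n + 2 * m + 3) / Real.Gamma (2 * (n : ℝ) + 2 * (m : ℝ) + 5)) *
            (y ^ (2 * β * (n : ℝ) + 2 * β - ε + 1) / (2 * β * (n : ℝ) + 2 * β - ε + 1)))
        (Real.cosh (lam * x ^ β) / (lam * x ^ (2 * β + α))) x := by
  intro x hx
  have tail_term : ∀ l y : ℝ, l ≠ 0 → 0 < y → ∀ n : ℕ,
      l ^ (2 * n + 2 * m + 3) / Real.Gamma (2 * (n : ℝ) + 2 * (m : ℝ) + 5) *
        y ^ (2 * β * (n : ℝ) + 2 * β - ε) =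
      (l * y ^ β) ^ (2 * (n + (m + 2))) / ((2 * (n + (m + 2))).factorial : ℝ) /
        (l * y ^ (2 * β + α)) := fun l y hl hy n =>
    pow_div_Gamma_mul_rpow hl hy (n + (m + 2)) (by ring) (by push_cast; ring)
      (by rw [hαm]; push_cast; ring)
  have d₁ := hasDerivAt_const_mul_rpow_div (c := 1 / lam) (p := -(2 * β + α)) hx
    (show 1 - 2 * β - α ≠ 0 by linarith) (by ring)
  have d₂ := hasDerivAt_const_mul_rpow_div
    (c := lam ^ (2 * m + 1) / Real.Gamma (2 * (m : ℝ) + 3)) (p := -ε) hx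
    (sub_ne_zero.2 hε₃.symm) (by ring)
  have d₃ := HasDerivAt.fun_sum (u := Finset.Icc (-(m : ℤ)) (-1 : ℤ)) fun n hn =>
    hasDerivAt_const_mul_rpow_div
      (c := lam ^ (2 * n + 2 * (m : ℤ) + 1) / Real.Gamma (2 * (n : ℝ) + 2 * (m : ℝ) + 3))
      (p := 2 * β * (n : ℝ) - ε) (q := 2 * β * (n : ℝ) - ε + 1) hx
      (fun h => hden n (Finset.mem_Icc.1 hn).1 (Finset.mem_Icc.1 hn).2 (by linarith)) rfl
  have d₄ := hasDerivAt_tsum_const_mul_rpow_div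
    (c := fun n : ℕ => lam ^ (2 * n + 2 * m + 3) / Real.Gamma (2 * (n : ℝ) + 2 * (m : ℝ) + 5))
    (p := fun n : ℕ => 2 * β * (n : ℝ) + 2 * β - ε)
    (q := fun n : ℕ => 2 * β * (n : ℝ) + 2 * β - ε + 1)
    (fun n => by
      have : 0 ≤ 2 * β * (n : ℝ) := by positivity
      linarith)
    (fun n => rfl)
    (fun y hy => by
      have h := (((summable_nat_add_iff (m + 2)).2
        (summable_pow_two_mul_div_factorial (|lam| * y ^ β))).div_const
          (|lam| * y ^ (2 * β + α)))
      refine h.congr fun n => ?_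
      have hΓ : 0 < Real.Gamma (2 * (n : ℝ) + 2 * (m : ℝ) + 5) :=
        Real.Gamma_pos_of_pos (by positivity)
      rw [abs_div, abs_pow, abs_of_pos hΓ, tail_term _ y (abs_ne_zero.2 hlam) hy n])
    hx
  refine (((d₁.add d₂).add d₃).add d₄).congr_deriv ?_
  set S : ℕ → ℝ := fun k =>
    (lam * x ^ β) ^ (2 * k) / ((2 * k).factorial : ℝ) / (lam * x ^ (2 * β + α)) with hS
  have hcosh : HasSum S (Real.cosh (lam * x ^ β) / (lam * x ^ (2 * β + α))) :=
    (Real.hasSum_cosh _).div_const _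
  have e₁ : 1 / lam * x ^ (-(2 * β + α)) = S 0 := by
    rw [Real.rpow_neg hx.le]
    simp [hS, mul_comm]
  have e₂ : lam ^ (2 * m + 1) / Real.Gamma (2 * (m : ℝ) + 3) * x ^ (-ε) = S (m + 1) :=
    pow_div_Gamma_mul_rpow hlam hx (m + 1) (by ring) (by push_cast; ring)
      (by rw [hαm]; push_cast; ring)
  have e₃ : ∑ n ∈ Finset.Icc (-(m : ℤ)) (-1 : ℤ),
      lam ^ (2 * n + 2 * (m : ℤ) + 1) / Real.Gamma (2 * (n : ℝ) + 2 * (m : ℝ) + 3) *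
        x ^ (2 * β * (n : ℝ) - ε) = ∑ k ∈ Finset.range m, S (k + 1) := by
    symm
    refine Finset.sum_bij (fun k _ => (k : ℤ) - m) (fun k hk => ?_) (fun a _ b _ h => ?_)
      (fun n hn => ?_) fun k _ => ?_
    · rw [Finset.mem_range] at hk
      rw [Finset.mem_Icc]
      omega
    · simpa using h
    · rw [Finset.mem_Icc] at hn
      exact ⟨(n + m).toNat, by rw [Finset.mem_range]; omega, by omega⟩
    · exact (zpow_div_Gamma_mul_rpow hlam hx (k + 1) (by push_cast; ring) (by push_cast; ring)
        (by rw [hαm]; push_cast; ring)).symm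
  rw [e₁, e₂, e₃, tsum_congr (tail_term lam x hlam hx), ← hcosh.tsum_eq, ← hcosh.summable.sum_add_tsum_nat_add (m + 2),
    Finset.sum_range_succ, Finset.sum_range_succ']
  ring
end

section
/- Let λ be a nonzero real number, let β, α be real numbers with β ≥ 1 and α > 1, and suppose α = mβ + 1 for a positive integer m. Define, for y > 0, F(y) = (1/λ) · y^{1-β-α}/(1-β-α) + (λ^{m}/Γ(m+2)) · log y + ∑_{n=-m}^{-1} (λ^{n+m}/Γ(n+m+2)) · y^{βn}/(βn) + ∑_{n=0}^{∞} (λ^{n+m+1}/Γ(n+m+3)) · y^{βn+β}/(βn+β). Then for every x > 0, F is differentiable at x and F′(x) = exp(λ x^β)/(λ x^{β+α}). -/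
open Real

theorem hasDerivAt_tsum_mul_pow_succ_div {c : ℕ → ℝ} {R z : ℝ}
    (hc : Summable fun n => |c n| * R ^ n) (hz : |z| < R) :
    HasDerivAt (fun w : ℝ => ∑' n : ℕ, c n * (w ^ (n + 1) / ((n : ℝ) + 1)))
      (∑' n : ℕ, c n * z ^ n) z := by
  have hR : 0 < R := (abs_nonneg z).trans_lt hz
  refine hasDerivAt_tsum_of_isPreconnected
    (g := fun n w => c n * (w ^ (n + 1) / ((n : ℝ) + 1))) (g' := fun n w => c n * w ^ n) (t := Set.Ioo (-R) R) (y₀ := 0) hc isOpen_Ioo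
    isPreconnected_Ioo ?_ ?_ ⟨neg_lt_zero.mpr hR, hR⟩ ?_ (abs_lt.mp hz)
  · intro n y _
    have hn : (n : ℝ) + 1 ≠ 0 := by positivity
    refine (((hasDerivAt_pow (n + 1) y).div_const ((n : ℝ) + 1)).const_mul (c n)).congr_deriv ?_
    push_cast
    rw [mul_div_cancel_left₀ _ hn]
  · intro n y hy
    rw [Real.norm_eq_abs, abs_mul, abs_pow]
    have := (abs_lt.mpr hy).le
    gcongr
  · simp

theorem hasDerivAt_tsum_mul_rpow_div {c : ℕ → ℝ} {β x : ℝ} (hβ : β ≠ 0) (hx : 0 < x)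
    (hc : ∀ R : ℝ, 0 < R → Summable fun n => |c n| * R ^ n) :
    HasDerivAt (fun y : ℝ => ∑' n : ℕ, c n * (y ^ (β * (n : ℝ) + β) / (β * (n : ℝ) + β)))
      (x ^ (β - 1) * ∑' n : ℕ, c n * (x ^ β) ^ n) x := by
  have hxβ : 0 < x ^ β := rpow_pos_of_pos hx β
  have hG := hasDerivAt_tsum_mul_pow_succ_div (z := x ^ β) (hc (x ^ β + 1) (by positivity))
    (by rw [abs_of_pos hxβ]; linarith)
  have hcomp := (hG.comp x (Real.hasDerivAt_rpow_const (p := β) (Or.inl hx.ne'))).div_const β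
  refine (hcomp.congr_deriv ?_).congr_of_eventuallyEq ?_
  · field_simp
  · filter_upwards [lt_mem_nhds hx] with y hy
    simp only [Function.comp_apply]
    rw [← tsum_div_const]
    refine tsum_congr fun n => ?_
    have hn : (n : ℝ) + 1 ≠ 0 := by positivity
    rw [show β * (n : ℝ) + β = β * ((n + 1 : ℕ) : ℝ) by push_cast; ring, rpow_mul hy.le,
      rpow_natCast]
    push_cast
    field_simp

theorem summable_abs_pow_div_factorial_mul_pow (lam : ℝ) (k l : ℕ) {R : ℝ} (hR : 0 ≤ R) :
    Summable fun n : ℕ => |lam ^ (n + k) / ((n + l).factorial : ℝ)| * R ^ n := by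
  refine Summable.of_nonneg_of_le (fun n => by positivity) (fun n => ?_)
    ((Real.summable_pow_div_factorial (|lam| * R)).mul_left (|lam| ^ k))
  rw [abs_div, abs_pow, Nat.abs_cast, pow_add, mul_pow]
  calc |lam| ^ n * |lam| ^ k / ((n + l).factorial : ℝ) * R ^ n
      = |lam| ^ k * (|lam| ^ n * R ^ n / ((n + l).factorial : ℝ)) := by ring
    _ ≤ |lam| ^ k * (|lam| ^ n * R ^ n / (n.factorial : ℝ)) := by
      have := Nat.factorial_le (Nat.le_add_right n l)
      gcongr

theorem exp_eq_sum_range_add_tsum (t : ℝ) (k : ℕ) :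
    Real.exp t = ∑ i ∈ Finset.range k, t ^ i / (i.factorial : ℝ) +
      ∑' n : ℕ, t ^ (n + k) / ((n + k).factorial : ℝ) := by
  rw [(Real.summable_pow_div_factorial t).sum_add_tsum_nat_add k, Real.exp_eq_exp_ℝ,
    NormedSpace.exp_eq_tsum_div]

theorem sum_Icc_neg_natCast_neg_one {M : Type*} [AddCommMonoid M] (m : ℕ) (f : ℤ → M) :
    ∑ n ∈ Finset.Icc (-(m : ℤ)) (-1), f n = ∑ i ∈ Finset.range m, f ((i : ℤ) - m) := by
  symm
  refine Finset.sum_nbij' (fun i : ℕ => (i : ℤ) - m) (fun n : ℤ => (n + m).toNat) ?_ ?_ ?_ ?_ ?_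
  all_goals simp only [Finset.mem_range, Finset.mem_Icc, implies_true]
  · omega
  · omega
  · omega
  · intro n hn
    omega

/-- Theorem 5, case ε = 1 (exponential integral with `α = mβ + 1`). -/
theorem exp_integral_eps_one (lam β α : ℝ) (hlam : lam ≠ 0) (hβ : 1 ≤ β) (hα : 1 < α)
    (m : ℕ) (hm : 0 < m) (hαm : α = m * β + 1) :
    ∀ x : ℝ, 0 < x →
      HasDerivAt (fun y : ℝ =>
        (1 / lam) * (y ^ (1 - β - α) / (1 - β - α)) +
        (lam ^ m / Real.Gamma ((m : ℝ) + 2)) * Real.log y +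
        (∑ n ∈ Finset.Icc (-(m : ℤ)) (-1 : ℤ),
          (lam ^ (n + (m : ℤ)) / Real.Gamma ((n : ℝ) + (m : ℝ) + 2)) *
            (y ^ (β * (n : ℝ)) / (β * (n : ℝ)))) +
        ∑' n : ℕ,
          (lam ^ (n + m + 1) / Real.Gamma ((n : ℝ) + (m : ℝ) + 3)) *
            (y ^ (β * (n : ℝ) + β) / (β * (n : ℝ) + β)))
        (Real.exp (lam * x ^ β) / (lam * x ^ (β + α))) x := by
  intro x hx
  have hβ0 : β ≠ 0 := by positivity
  have hΓ (k : ℕ) : Real.Gamma ((k : ℝ) + 2) = ((k + 1).factorial : ℝ) := by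
    rw [← Real.Gamma_nat_eq_factorial]
    push_cast
    ring_nf
  have hΓ' (n : ℕ) : Real.Gamma ((n : ℝ) + (m : ℝ) + 3) = ((n + (m + 2)).factorial : ℝ) := by
    rw [← Real.Gamma_nat_eq_factorial]
    push_cast
    ring_nf
  have hpow (p : ℝ) (hp : p ≠ 0) : HasDerivAt (fun y : ℝ => y ^ p / p) (x ^ (p - 1)) x :=
    ((Real.hasDerivAt_rpow_const (Or.inl hx.ne')).div_const p).congr_deriv
      (mul_div_cancel_left₀ _ hp)
  have hsum (i : ℕ) (hi : i ∈ Finset.range m) :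
      HasDerivAt (fun y : ℝ => lam ^ i / ((i + 1).factorial : ℝ) *
        (y ^ (β * ((i : ℝ) - m)) / (β * ((i : ℝ) - m))))
        (lam ^ i / ((i + 1).factorial : ℝ) * x ^ (β * ((i : ℝ) - m) - 1)) x := by
    refine (hpow _ (mul_ne_zero hβ0 (sub_ne_zero.mpr ?_))).const_mul _
    exact_mod_cast (Finset.mem_range.mp hi).ne
  have hseries := hasDerivAt_tsum_mul_rpow_div hβ0 hx
    fun R hR => summable_abs_pow_div_factorial_mul_pow lam (m + 1) (m + 2) hR.le
  have hF := ((((hpow (1 - β - α) (by linarith)).const_mul (1 / lam)).add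
    ((Real.hasDerivAt_log hx.ne').const_mul (lam ^ m / ((m + 1).factorial : ℝ)))).add
    (HasDerivAt.fun_sum hsum)).add hseries
  refine (hF.congr_deriv ?_).congr_of_eventuallyEq (Filter.Eventually.of_forall fun y => ?_)
  · have hX : x ^ (β + α) = (x ^ β) ^ (m + 1) * x := by
      rw [← rpow_natCast, ← rpow_mul hx.le, ← rpow_add_one hx.ne', hαm]
      push_cast
      ring_nf
    have hxβ : x ^ β ≠ 0 := (rpow_pos_of_pos hx β).ne'
    have hx0 : x ≠ 0 := hx.ne'
    rw [exp_eq_sum_range_add_tsum (lam * x ^ β) (m + 2), Finset.sum_range_succ,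
      Finset.sum_range_succ', add_div, add_div, add_div, Finset.sum_div, ← tsum_div_const,
      ← tsum_mul_left]
    have h_first : 1 / lam * x ^ (1 - β - α - 1) =
        (lam * x ^ β) ^ 0 / (Nat.factorial 0 : ℝ) / (lam * x ^ (β + α)) := by
      rw [show 1 - β - α - 1 = -(β + α) by ring, rpow_neg hx.le]
      simp [mul_comm]
    have h_log : lam ^ m / ((m + 1).factorial : ℝ) * x⁻¹ =
        (lam * x ^ β) ^ (m + 1) / ((m + 1).factorial : ℝ) / (lam * x ^ (β + α)) := by
      rw [hX, mul_pow]
      field_simp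
      ring
    have h_finite (i : ℕ) : lam ^ i / ((i + 1).factorial : ℝ) * x ^ (β * ((i : ℝ) - m) - 1) =
        (lam * x ^ β) ^ (i + 1) / ((i + 1).factorial : ℝ) / (lam * x ^ (β + α)) := by
      rw [hX, mul_pow, rpow_sub_one hx0, mul_sub, rpow_sub hx, rpow_mul_natCast hx.le,
        rpow_mul_natCast hx.le]
      field_simp
      ring
    have h_tail (n : ℕ) : x ^ (β - 1) *
        (lam ^ (n + (m + 1)) / ((n + (m + 2)).factorial : ℝ) * (x ^ β) ^ n) =
        (lam * x ^ β) ^ (n + (m + 2)) / ((n + (m + 2)).factorial : ℝ) /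
          (lam * x ^ (β + α)) := by
      rw [hX, mul_pow, rpow_sub_one hx0]
      field_simp
      ring
    simp only [h_first, h_log, h_finite, h_tail]
    ring
  · beta_reduce
    rw [sum_Icc_neg_natCast_neg_one]
    simp only [Pi.add_apply, Int.cast_sub, Int.cast_natCast, sub_add_cancel, zpow_natCast, hΓ, hΓ']
    simp only [add_assoc]
end
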